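/- arXiv:2309.11366 — 2 statements merged into one kernel-verified Lean document; each statement's English description precedes it below -/
import Mathlib

section
/- For every finite set 𝓕 of finite simple graphs there exists a constant c ≥ 2 such that the following holds: for every finite simple graph G, every nonempty vertex set S ⊆ V(G), every set T ⊆ V(G) \ S, and every natural number k, the number of vertex sets C that are seclusion-maximal with respect to the property "G[C] is connected, G[C] is 𝓕-free, |N_G(C)| ≤ k, and S ⊆ C ⊆ V(G) \ T" is at most c^(k+1). -/
open SimpleGraph

/-- The open neighborhood of a vertex set `C` in a graph `G`. -/
def openNbhd {V : Type} (G : SimpleGraph V) (C : Set V) : Set V :=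
  {v | v ∉ C ∧ ∃ u ∈ C, G.Adj u v}

/-- `C` is seclusion-maximal for property `Pr`: it satisfies `Pr` and every strict
superset satisfying `Pr` has a strictly larger open neighborhood. -/
def SeclusionMaximal {V : Type} (G : SimpleGraph V) (Pr : Set V → Prop) (C : Set V) : Prop :=
  Pr C ∧ ∀ C' : Set V, C ⊂ C' → Pr C' → (openNbhd G C).ncard < (openNbhd G C').ncard

/-- Submodularity of the size of the open neighborhood. -/
theorem ncard_openNbhd_inter_add_ncard_openNbhd_union_le {V : Type} [Fintype V]
    (G : SimpleGraph V) (A B : Set V) :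
    (openNbhd G (A ∩ B)).ncard + (openNbhd G (A ∪ B)).ncard ≤
      (openNbhd G A).ncard + (openNbhd G B).ncard := by
  rw [← Set.ncard_union_add_ncard_inter (openNbhd G (A ∩ B)) (openNbhd G (A ∪ B)),
    ← Set.ncard_union_add_ncard_inter (openNbhd G A) (openNbhd G B), add_comm,
    add_comm (openNbhd G A ∪ _).ncard]
  refine Nat.add_le_add (Set.ncard_le_ncard ?_) (Set.ncard_le_ncard ?_)
  · rintro v ⟨⟨-, u, hu, huv⟩, hv, -⟩
    exact ⟨⟨fun h => hv (Or.inl h), u, hu.1, huv⟩, ⟨fun h => hv (Or.inr h), u, hu.2, huv⟩⟩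
  · rintro v (⟨hv, u, hu, huv⟩ | ⟨hv, u, hu, huv⟩)
    · by_cases hA : v ∈ A
      · exact Or.inr ⟨fun hB => hv ⟨hA, hB⟩, u, hu.2, huv⟩
      · exact Or.inl ⟨hA, u, hu.1, huv⟩
    · rcases hu with hu | hu
      · exact Or.inl ⟨fun h => hv (Or.inl h), u, hu, huv⟩
      · exact Or.inr ⟨fun h => hv (Or.inr h), u, hu, huv⟩

/-- A connected set containing a nonempty set `S` but none of its neighbors equals `S`. -/
theorem eq_of_connected_of_disjoint_openNbhd {V : Type} {G : SimpleGraph V} {S C : Set V}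
    (hC : (G.induce C).Connected) (hS : S.Nonempty) (hSC : S ⊆ C)
    (hdisj : ∀ v ∈ openNbhd G S, v ∉ C) : C = S := by
  refine Set.Subset.antisymm (fun v hv => ?_) hSC
  by_contra hvS
  obtain ⟨s, hs⟩ := hS
  obtain ⟨p⟩ := hC.preconnected ⟨s, hSC hs⟩ ⟨v, hv⟩
  obtain ⟨d, -, h₁, h₂⟩ := p.exists_boundary_dart {x | x.1 ∈ S} hs hvS
  exact hdisj d.snd.1 ⟨h₂, d.fst.1, h₁, d.adj⟩ d.snd.2

/-- A connected subset of `X` extends to a connected subset of `X` none of whose neighbors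
lies in `X`. -/
theorem exists_connected_superset {V : Type} [Fintype V] {G : SimpleGraph V} {C X : Set V}
    (hC : (G.induce C).Connected) (hCX : C ⊆ X) :
    ∃ C', C ⊆ C' ∧ C' ⊆ X ∧ (G.induce C').Connected ∧ ∀ v ∈ openNbhd G C', v ∉ X := by
  obtain ⟨C', hle, hmax⟩ := Finite.exists_le_maximal
    (p := fun A : Set V => A ⊆ X ∧ (G.induce A).Connected) ⟨hCX, hC⟩
  refine ⟨C', hle, hmax.prop.1, hmax.prop.2, ?_⟩
  rintro v ⟨hv, u, hu, huv⟩ hvX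
  refine hv (hmax.le_of_ge (y := C' ∪ {u, v}) ⟨?_, ?_⟩ Set.subset_union_left (by simp))
  · rintro x (hx | rfl | rfl)
    exacts [hmax.prop.1 hx, hmax.prop.1 hu, hvX]
  · exact induce_union_connected hmax.prop.2.preconnected
      (induce_pair_connected_of_adj huv).preconnected ⟨u, hu, by simp⟩

/-- The smallest size of an open neighborhood of a set containing `S` and avoiding `T`. -/
noncomputable def minNbhd {V : Type} (G : SimpleGraph V) (S T : Set V) : ℕ :=
  sInf ((fun A => (openNbhd G A).ncard) '' {A | S ⊆ A ∧ A ⊆ Tᶜ})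

theorem minNbhd_le {V : Type} (G : SimpleGraph V) {S T A : Set V} (hS : S ⊆ A) (hT : A ⊆ Tᶜ) :
    minNbhd G S T ≤ (openNbhd G A).ncard :=
  Nat.sInf_le ⟨A, ⟨hS, hT⟩, rfl⟩

theorem exists_ncard_openNbhd_eq_minNbhd {V : Type} (G : SimpleGraph V) {S T C : Set V}
    (hS : S ⊆ C) (hT : C ⊆ Tᶜ) :
    ∃ A, S ⊆ A ∧ A ⊆ Tᶜ ∧ (openNbhd G A).ncard = minNbhd G S T := by
  obtain ⟨A, hA, h⟩ := Nat.sInf_mem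
    (s := (fun A => (openNbhd G A).ncard) '' {A | S ⊆ A ∧ A ⊆ Tᶜ}) ⟨_, C, ⟨hS, hT⟩, rfl⟩
  exact ⟨A, hA.1, hA.2, h⟩

theorem minNbhd_mono {V : Type} (G : SimpleGraph V) {S T S' T' C : Set V}
    (hS : S ⊆ S') (hT : T ⊆ T') (hSC : S' ⊆ C) (hCT : C ⊆ T'ᶜ) :
    minNbhd G S T ≤ minNbhd G S' T' := by
  obtain ⟨A, h₁, h₂, h₃⟩ := exists_ncard_openNbhd_eq_minNbhd G hSC hCT
  rw [← h₃]
  exact minNbhd_le G (hS.trans h₁) (h₂.trans (Set.compl_subset_compl.2 hT))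

/-- `D` is the least set among those that attain `minNbhd G S T`. -/
structure IsClosest {V : Type} (G : SimpleGraph V) (S T D : Set V) : Prop where
  subset : S ⊆ D
  subset_compl : D ⊆ Tᶜ
  ncard_eq : (openNbhd G D).ncard = minNbhd G S T
  le : ∀ A, S ⊆ A → A ⊆ Tᶜ → (openNbhd G A).ncard ≤ minNbhd G S T → D ⊆ A

theorem exists_isClosest {V : Type} [Fintype V] (G : SimpleGraph V) {S T C : Set V}
    (hS : S ⊆ C) (hT : C ⊆ Tᶜ) : ∃ D, IsClosest G S T D := by
  obtain ⟨A, hA⟩ := exists_ncard_openNbhd_eq_minNbhd G hS hT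
  obtain ⟨D, -, hD⟩ := Finite.exists_le_minimal
    (p := fun A : Set V => S ⊆ A ∧ A ⊆ Tᶜ ∧ (openNbhd G A).ncard = minNbhd G S T) hA
  refine ⟨D, hD.prop.1, hD.prop.2.1, hD.prop.2.2, fun B hSB hBT hB => ?_⟩
  have h₁ := ncard_openNbhd_inter_add_ncard_openNbhd_union_le G D B
  have h₂ := minNbhd_le G (hD.prop.1.trans Set.subset_union_left) (Set.union_subset hD.prop.2.1 hBT)
  have h₃ := hD.prop.2.2
  have hSI := Set.subset_inter hD.prop.1 hSB
  have hIT : D ∩ B ⊆ Tᶜ := Set.inter_subset_left.trans hD.prop.2.1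
  have h₄ := minNbhd_le G hSI hIT
  exact (hD.le_of_le ⟨hSI, hIT, by omega⟩ Set.inter_subset_left).trans Set.inter_subset_right

theorem IsClosest.mono {V : Type} {G : SimpleGraph V} {S T S' D D' : Set V}
    (h : IsClosest G S T D) (h' : IsClosest G S' T D') (hS : S ⊆ S')
    (heq : minNbhd G S T = minNbhd G S' T) : D ⊆ D' :=
  h.le D' (hS.trans h'.subset) h'.subset_compl (by rw [h'.ncard_eq, heq])

theorem IsClosest.minNbhd_lt {V : Type} {G : SimpleGraph V} {S T D C : Set V}
    (h : IsClosest G S T D) {z : V} (hz : z ∈ D) (hS : S ⊆ C) (hT : C ⊆ (insert z T)ᶜ) :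
    minNbhd G S T < minNbhd G S (insert z T) := by
  obtain ⟨A, h₁, h₂, h₃⟩ := exists_ncard_openNbhd_eq_minNbhd G hS hT
  by_contra! hle
  exact h₂ (h.le A h₁ (h₂.trans (Set.compl_subset_compl.2 (Set.subset_insert _ _)))
    (h₃.trans_le hle) hz) (Set.mem_insert _ _)

/-- The induced subgraphs of the graphs `Gf i` that embed into `G.induce S`. -/
def shapes {ι : Type} {Fv : ι → Type} (Gf : ∀ i, SimpleGraph (Fv i)) {V : Type}
    (G : SimpleGraph V) (S : Set V) : Set (Σ i, Set (Fv i)) :=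
  {σ | Nonempty ((Gf σ.1).induce σ.2 ↪g G.induce S)}

theorem shapes_mono {ι : Type} {Fv : ι → Type} (Gf : ∀ i, SimpleGraph (Fv i)) {V : Type}
    (G : SimpleGraph V) {S S' : Set V} (h : S ⊆ S') : shapes Gf G S ⊆ shapes Gf G S' :=
  fun _ ⟨f⟩ => ⟨f.trans (SimpleGraph.induceHomOfLE G h)⟩

/-- The potential that increases along the branching. -/
noncomputable def potential {ι : Type} {Fv : ι → Type} (Gf : ∀ i, SimpleGraph (Fv i))
    {V : Type} (G : SimpleGraph V) (S T : Set V) : ℕ :=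
  minNbhd G S T + (openNbhd G S ∩ T).ncard + (shapes Gf G S).ncard

theorem openNbhd_inter_subset {V : Type} (G : SimpleGraph V) {S T S' T' C : Set V}
    (hS : S ⊆ S') (hT : T ⊆ T') (hSC : S' ⊆ C) (hCT : C ⊆ T'ᶜ) :
    openNbhd G S ∩ T ⊆ openNbhd G S' ∩ T' := by
  rintro v ⟨⟨-, u, hu, huv⟩, hvT⟩
  exact ⟨⟨fun hv => hCT (hSC hv) (hT hvT), u, hS hu, huv⟩, hT hvT⟩

theorem potential_mono {ι : Type} [Fintype ι] {Fv : ι → Type} [∀ i, Fintype (Fv i)]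
    (Gf : ∀ i, SimpleGraph (Fv i)) {V : Type} [Fintype V] (G : SimpleGraph V)
    {S T S' T' C : Set V} (hS : S ⊆ S') (hT : T ⊆ T') (hSC : S' ⊆ C) (hCT : C ⊆ T'ᶜ) :
    potential Gf G S T ≤ potential Gf G S' T' :=
  Nat.add_le_add (Nat.add_le_add (minNbhd_mono G hS hT hSC hCT)
    (Set.ncard_le_ncard (openNbhd_inter_subset G hS hT hSC hCT)))
    (Set.ncard_le_ncard (shapes_mono Gf G hS))

/-- The members of `𝓜` that contain `S` and avoid `T`. -/
def membersBetween {V : Type} (𝓜 : Set (Set V)) (S T : Set V) : Set (Set V) :=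
  {C | C ∈ 𝓜 ∧ S ⊆ C ∧ C ⊆ Tᶜ}

theorem ncard_membersBetween_anti {V : Type} [Fintype V] (𝓜 : Set (Set V)) {S S' : Set V}
    (T : Set V) (h : S ⊆ S') :
    (membersBetween 𝓜 S' T).ncard ≤ (membersBetween 𝓜 S T).ncard :=
  Set.ncard_le_ncard fun _ hC => ⟨hC.1, h.trans hC.2.1, hC.2.2⟩

theorem ncard_membersBetween_le_add {V : Type} [Fintype V] (𝓜 : Set (Set V)) (S T : Set V)
    (z : V) : (membersBetween 𝓜 S T).ncard ≤
      (membersBetween 𝓜 (insert z S) T).ncard + (membersBetween 𝓜 S (insert z T)).ncard := by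
  refine (Set.ncard_le_ncard ?_).trans (Set.ncard_union_le _ _)
  intro C hC
  by_cases hz : z ∈ C
  · exact Or.inl ⟨hC.1, Set.insert_subset hz hC.2.1, hC.2.2⟩
  · refine Or.inr ⟨hC.1, hC.2.1, ?_⟩
    rintro x hx (rfl | hxT)
    exacts [hz hx, hC.2.2 hx hxT]

theorem exists_mem_membersBetween {V : Type} {𝓜 : Set (Set V)} {S T : Set V} {n : ℕ}
    (h : n < (membersBetween 𝓜 S T).ncard) : ∃ C, C ∈ 𝓜 ∧ S ⊆ C ∧ C ⊆ Tᶜ := by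
  by_contra! hC
  rw [(Set.eq_empty_iff_forall_notMem (s := membersBetween 𝓜 S T)).2
    fun C hC' => hC C hC'.1 hC'.2.1 hC'.2.2] at h
  simp at h

/-- `h` bounds the number of members of `𝓜` between every pair obtained from `(S, T)` by
enlarging `S` and `T` and increasing the potential. -/
def BoundsProgress {ι : Type} {Fv : ι → Type} (Gf : ∀ i, SimpleGraph (Fv i)) {V : Type}
    (G : SimpleGraph V) (𝓜 : Set (Set V)) (S T : Set V) (h : ℕ) : Prop :=
  ∀ S' T', S ⊆ S' → T ⊆ T' → potential Gf G S T < potential Gf G S' T' →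
    (membersBetween 𝓜 S' T').ncard ≤ h

section Branching

variable {ι : Type} [Fintype ι] {Fv : ι → Type} [∀ i, Fintype (Fv i)]
  {Gf : ∀ i, SimpleGraph (Fv i)} {V : Type} [Fintype V] {G : SimpleGraph V}
  {𝓜 : Set (Set V)} {S T Y : Set V} {h n : ℕ}

theorem potential_eq_of_lt (hh : BoundsProgress Gf G 𝓜 S T h) (hSY : S ⊆ Y)
    (hY : h < (membersBetween 𝓜 Y T).ncard) :
    minNbhd G S T = minNbhd G Y T ∧ shapes Gf G S = shapes Gf G Y := by
  obtain ⟨C, -, hYC, hCT⟩ := exists_mem_membersBetween hY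
  have hle : potential Gf G Y T ≤ potential Gf G S T := by
    by_contra! hlt
    exact absurd (hh Y T hSY (Set.Subset.refl T) hlt) (by omega)
  have h₁ := minNbhd_mono G hSY (Set.Subset.refl T) hYC hCT
  have h₂ := Set.ncard_le_ncard (openNbhd_inter_subset G hSY (Set.Subset.refl T) hYC hCT)
  have h₃ := Set.ncard_le_ncard (shapes_mono Gf G hSY)
  unfold potential at hle
  exact ⟨by omega, Set.eq_of_subset_of_ncard_le (shapes_mono Gf G hSY) (by omega)⟩

theorem lt_ncard_insert_of_mem_closest (hh : BoundsProgress Gf G 𝓜 S T h) (hSY : S ⊆ Y)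
    (hY : (n + 1) * h < (membersBetween 𝓜 Y T).ncard) {D : Set V} (hD : IsClosest G Y T D)
    {z : V} (hz : z ∈ D) : n * h < (membersBetween 𝓜 (insert z Y) T).ncard := by
  have hadd := ncard_membersBetween_le_add 𝓜 Y T z
  suffices (membersBetween 𝓜 Y (insert z T)).ncard ≤ h by
    rw [Nat.succ_mul] at hY
    omega
  by_contra! hlt
  obtain ⟨C, -, hYC, hCT⟩ := exists_mem_membersBetween hlt
  have hTz := Set.subset_insert z T
  have h₁ := hD.minNbhd_lt hz hYC hCT
  have h₀ := minNbhd_mono G hSY (Set.Subset.refl T) hYC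
    (hCT.trans (Set.compl_subset_compl.2 hTz))
  have h₂ := Set.ncard_le_ncard (openNbhd_inter_subset G hSY hTz hYC hCT)
  have h₃ := Set.ncard_le_ncard (shapes_mono Gf G hSY)
  refine absurd (hh Y (insert z T) hSY hTz ?_) (by omega)
  unfold potential
  omega

theorem lt_ncard_insert_of_adj_mem (hh : BoundsProgress Gf G 𝓜 S T h) (hSY : S ⊆ Y)
    (hY : (n + 1) * h < (membersBetween 𝓜 Y T).ncard) {w w' : V} (hw' : w' ∈ Y)
    (hadj : G.Adj w' w) (hwT : w ∉ T) :
    n * h < (membersBetween 𝓜 (insert w Y) T).ncard := by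
  have hadd := ncard_membersBetween_le_add 𝓜 Y T w
  suffices (membersBetween 𝓜 Y (insert w T)).ncard ≤ h by
    rw [Nat.succ_mul] at hY
    omega
  by_contra! hlt
  obtain ⟨C, -, hYC, hCT⟩ := exists_mem_membersBetween hlt
  have hTw := Set.subset_insert w T
  have h₁ := minNbhd_mono G hSY hTw hYC hCT
  have h₂ : (openNbhd G S ∩ T).ncard < (openNbhd G Y ∩ insert w T).ncard := by
    refine Set.ncard_lt_ncard (Set.ssubset_iff_exists.2
      ⟨openNbhd_inter_subset G hSY hTw hYC hCT, w, ?_, fun hmem => hwT hmem.2⟩)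
    exact ⟨⟨fun hwY => hCT (hYC hwY) (Set.mem_insert _ _), w', hw', hadj⟩, Set.mem_insert _ _⟩
  have h₃ := Set.ncard_le_ncard (shapes_mono Gf G hSY)
  refine absurd (hh Y (insert w T) hSY hTw ?_) (by omega)
  unfold potential
  omega

/-- The vertices within distance `j` of `U` in the graph obtained by deleting `T`. -/
def ballAvoiding {V : Type} (G : SimpleGraph V) (T U : Set V) : ℕ → Set V
  | 0 => U
  | j + 1 => ballAvoiding G T U j ∪ (openNbhd G (ballAvoiding G T U j) \ T)

theorem ballAvoiding_mono {V : Type} (G : SimpleGraph V) (T U : Set V) :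
    Monotone (ballAvoiding G T U) :=
  monotone_nat_of_le_succ fun _ => Set.subset_union_left

theorem lt_ncard_insert_of_mem_ballAvoiding (hh : BoundsProgress Gf G 𝓜 S T h) {w : V}
    {U : Set V} (hU : IsClosest G (insert w S) T U) (j : ℕ) :
    ∀ {z : V}, z ∈ ballAvoiding G T U j → ∀ {Y : Set V} {n : ℕ}, insert w S ⊆ Y →
      (n + 2 * j + 2) * h < (membersBetween 𝓜 Y T).ncard →
      n * h < (membersBetween 𝓜 (insert z Y) T).ncard := by
  have key : ∀ {Y : Set V} {n : ℕ}, insert w S ⊆ Y →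
      (n + 1) * h < (membersBetween 𝓜 Y T).ncard → ∃ D, IsClosest G Y T D ∧ U ⊆ D := by
    intro Y n hY hlt
    have hSw := Set.subset_insert w S
    have hY' : h < (membersBetween 𝓜 Y T).ncard :=
      lt_of_le_of_lt (Nat.le_mul_of_pos_left h n.succ_pos) hlt
    obtain ⟨C, -, hYC, hCT⟩ := exists_mem_membersBetween hlt
    obtain ⟨D, hD⟩ := exists_isClosest G hYC hCT
    refine ⟨D, hD, hU.mono hD hY ?_⟩
    rw [← (potential_eq_of_lt hh (hSw.trans hY) hY').1, (potential_eq_of_lt hh hSw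
      (hY'.trans_le (ncard_membersBetween_anti 𝓜 T hY))).1]
  induction j with
  | zero =>
    intro z hz Y n hY hlt
    obtain ⟨D, hD, hUD⟩ := key hY hlt
    have := lt_ncard_insert_of_mem_closest hh ((Set.subset_insert w S).trans hY) hlt hD (hUD hz)
    exact lt_of_le_of_lt (Nat.mul_le_mul_right h (by omega)) this
  | succ j ih =>
    rintro z (hz | ⟨⟨-, z', hz', hadj⟩, hzT⟩) Y n hY hlt
    · exact ih hz hY (lt_of_le_of_lt (Nat.mul_le_mul_right h (by omega)) hlt)
    · have h₁ := ih hz' (n := n + 2) hY (lt_of_le_of_lt (Nat.mul_le_mul_right h (by omega)) hlt)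
      have hSY := ((Set.subset_insert w S).trans hY).trans (Set.subset_insert z' Y)
      have h₂ := lt_ncard_insert_of_adj_mem hh hSY h₁ (Set.mem_insert z' Y) hadj hzT
      refine lt_of_le_of_lt (Nat.mul_le_mul_right h (by omega)) (h₂.trans_le
        (ncard_membersBetween_anti 𝓜 T (Set.insert_subset_insert (Set.subset_insert z' Y))))

theorem exists_superset_lt_ncard (hh : BoundsProgress Gf G 𝓜 S T h) {w : V} {U : Set V}
    (hU : IsClosest G (insert w S) T U) (j : ℕ) (Z : Finset V) :
    (Z : Set V) ⊆ ballAvoiding G T U j → ∀ {n : ℕ},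
      (n + (2 * j + 2) * Z.card) * h < (membersBetween 𝓜 (insert w S) T).ncard →
      ∃ Y, insert w S ⊆ Y ∧ (Z : Set V) ⊆ Y ∧ n * h < (membersBetween 𝓜 Y T).ncard := by
  classical
  induction Z using Finset.induction_on with
  | empty =>
    intro _ n hlt
    exact ⟨insert w S, Set.Subset.refl _, by simp, by simpa using hlt⟩
  | insert z Z hz ih =>
    intro hZ n hlt
    rw [Finset.coe_insert, Set.insert_subset_iff] at hZ
    rw [Finset.card_insert_of_notMem hz] at hlt
    obtain ⟨Y, hY, hZY, hlt'⟩ := ih hZ.2 (n := n + 2 * j + 2)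
      (lt_of_le_of_lt (Nat.mul_le_mul_right h (by ring_nf; omega)) hlt)
    refine ⟨insert z Y, hY.trans (Set.subset_insert _ _), ?_,
      lt_ncard_insert_of_mem_ballAvoiding hh hU j hZ.1 hY hlt'⟩
    rw [Finset.coe_insert]
    exact Set.insert_subset_insert hZY

end Branching

/-- A function on a small type misses one of the differences of a growing sequence of sets. -/
theorem exists_missed_layer {W V : Type} [Fintype W] {U : ℕ → Set V} (hU : Monotone U)
    (f : W → V) {m : ℕ} (hm : Fintype.card W ≤ m) :
    ∃ j ≤ m, ∀ x, f x ∈ U (j + 1) → f x ∈ U j := by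
  by_contra! hcon
  choose g hg₁ hg₂ using fun j : Fin (m + 1) => hcon j (Nat.lt_succ_iff.1 j.2)
  have hlt : ∀ a b : Fin (m + 1), a < b → g a ≠ g b := fun a b hab heq =>
    hg₂ b (heq ▸ hU (Nat.succ_le_of_lt hab) (hg₁ a))
  have hinj : Function.Injective g := fun a b heq => by
    rcases lt_trichotomy a b with hab | hab | hab
    exacts [absurd heq (hlt a b hab), hab, absurd heq.symm (hlt b a hab)]
  have := Fintype.card_le_of_injective g hinj
  simp only [Fintype.card_fin] at this
  omega

/-- An embedded copy of `F` whose part on `A` is not joined to the rest can be rerouted by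
replacing that part with another copy that is not joined to the rest either. -/
theorem nonempty_embedding_of_replace {W V : Type} {F : SimpleGraph W} {G : SimpleGraph V}
    {X S C : Set V} (H : F ↪g G.induce X) (A : Set W) (g : F.induce A ↪g G.induce S)
    (hS : S ⊆ C) (hout : ∀ x ∉ A, (H x).1 ∈ C)
    (hne : ∀ x ∉ A, (H x).1 ∉ S) (hsep : ∀ x ∉ A, ∀ s ∈ S, ¬ G.Adj s (H x).1)
    (hA : ∀ x ∈ A, ∀ y ∉ A, ¬ F.Adj x y) : Nonempty (F ↪g G.induce C) := by
  classical
  let φ : W → C := fun x =>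
    if hx : x ∈ A then ⟨(g ⟨x, hx⟩).1, hS (g ⟨x, hx⟩).2⟩ else ⟨(H x).1, hout x hx⟩
  have hφA : ∀ x (hx : x ∈ A), (φ x).1 = (g ⟨x, hx⟩).1 := fun x hx => by simp [φ, hx]
  have hφ : ∀ x ∉ A, (φ x).1 = (H x).1 := fun x hx => by simp [φ, hx]
  refine ⟨⟨⟨φ, fun x y hxy => ?_⟩, fun {x y} => ?_⟩⟩
  · have hxy' := congrArg Subtype.val hxy
    by_cases hx : x ∈ A <;> by_cases hy : y ∈ A
    · rw [hφA x hx, hφA y hy] at hxy'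
      exact congrArg Subtype.val (g.injective (Subtype.ext hxy'))
    · rw [hφA x hx, hφ y hy] at hxy'
      exact absurd (hxy' ▸ (g ⟨x, hx⟩).2) (hne y hy)
    · rw [hφ x hx, hφA y hy] at hxy'
      exact absurd (hxy' ▸ (g ⟨y, hy⟩).2) (hne x hx)
    · rw [hφ x hx, hφ y hy] at hxy'
      exact H.injective (Subtype.ext hxy')
  · change G.Adj (φ x).1 (φ y).1 ↔ F.Adj x y
    by_cases hx : x ∈ A <;> by_cases hy : y ∈ A
    · rw [hφA x hx, hφA y hy]
      exact g.map_adj_iff (v := ⟨x, hx⟩) (w := ⟨y, hy⟩)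
    · rw [hφA x hx, hφ y hy]
      exact iff_of_false (hsep y hy _ (g ⟨x, hx⟩).2) (hA x hx y hy)
    · rw [hφ x hx, hφA y hy]
      exact iff_of_false (fun hadj => hsep x hx _ (g ⟨y, hy⟩).2 hadj.symm)
        (fun hadj => hA y hy x hx hadj.symm)
    · rw [hφ x hx, hφ y hy]
      exact H.map_adj_iff

section Free

variable {ι : Type} [Fintype ι] {Fv : ι → Type} [∀ i, Fintype (Fv i)]
  {Gf : ∀ i, SimpleGraph (Fv i)} {V : Type} [Fintype V] {G : SimpleGraph V}
  {𝓜 : Set (Set V)} {S T : Set V} {h m : ℕ}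

theorem isEmpty_embedding_union_closest (hh : BoundsProgress Gf G 𝓜 S T h)
    (hm : ∀ i, Fintype.card (Fv i) ≤ m) {w : V} {U : Set V}
    (hU : IsClosest G (insert w S) T U)
    (hlt : (1 + (2 * m + 2) * m) * h < (membersBetween 𝓜 (insert w S) T).ncard)
    {C : Set V} (hSC : S ⊆ C) (hCT : C ⊆ Tᶜ) (hfree : ∀ i, IsEmpty (Gf i ↪g G.induce C))
    (i : ι) : IsEmpty (Gf i ↪g G.induce (C ∪ U)) := by
  classical
  refine ⟨fun H => ?_⟩
  obtain ⟨j, hj, hmiss⟩ := exists_missed_layer (ballAvoiding_mono G T U)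
    (fun x => (H x).1) (hm i)
  have hSU : S ⊆ U := (Set.subset_insert w S).trans hU.subset
  have hUj : U ⊆ ballAvoiding G T U j := ballAvoiding_mono G T U (Nat.zero_le j)
  let A : Set (Fv i) := {x | (H x).1 ∈ ballAvoiding G T U j}
  let Z : Finset V := Finset.univ.filter (· ∈ A) |>.image fun x => (H x).1
  have hZcard : Z.card ≤ m :=
    Finset.card_image_le.trans ((Finset.card_le_univ _).trans (hm i))
  have hZ : (Z : Set V) ⊆ ballAvoiding G T U j := by
    intro z hz
    simp only [Z, Finset.coe_image, Set.mem_image, Finset.mem_coe, Finset.mem_filter] at hz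
    obtain ⟨x, ⟨-, hx⟩, rfl⟩ := hz
    exact hx
  obtain ⟨Y, hY, hZY, hYlt⟩ := exists_superset_lt_ncard hh hU j Z hZ (n := 1)
    (lt_of_le_of_lt (Nat.mul_le_mul_right h (Nat.add_le_add_left
      (Nat.mul_le_mul (by omega) hZcard) 1)) hlt)
  rw [one_mul] at hYlt
  have hshape : (⟨i, A⟩ : Σ i, Set (Fv i)) ∈ shapes Gf G S := by
    rw [(potential_eq_of_lt hh ((Set.subset_insert w S).trans hY) hYlt).2]
    refine ⟨⟨⟨fun x => ⟨(H x.1).1, hZY ?_⟩, fun x y hxy => ?_⟩, fun {x y} => ?_⟩⟩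
    · simp only [Z, Finset.coe_image, Set.mem_image, Finset.mem_coe, Finset.mem_filter]
      exact ⟨x.1, ⟨Finset.mem_univ _, x.2⟩, rfl⟩
    · have hval : (H x.1).1 = (H y.1).1 := congrArg (fun v : Y => v.1) hxy
      exact Subtype.ext (H.injective (Subtype.ext hval))
    · exact H.map_adj_iff
  obtain ⟨g⟩ := hshape
  have hHT : ∀ x, (H x).1 ∉ T := fun x => Set.union_subset hCT hU.subset_compl (H x).2
  have hfar : ∀ x ∉ A, ∀ u ∈ ballAvoiding G T U j, ¬ G.Adj u (H x).1 :=
    fun x hx u hu hadj => hx (hmiss x (Or.inr ⟨⟨hx, u, hu, hadj⟩, hHT x⟩))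
  obtain ⟨f⟩ := nonempty_embedding_of_replace H A g hSC
    (fun x hx => (H x).2.resolve_right fun hxU => hx (hUj hxU))
    (fun x hx hxS => hx (hUj (hSU hxS)))
    (fun x hx s hs => hfar x hx s (hUj (hSU hs)))
    (fun x hx y hy hadj => hfar y hy _ hx (H.map_adj_iff.2 hadj))
  exact (hfree i).false f

end Free

/-- The property of being connected, induced-`Gf`-free, `k`-secluded, and between `S` and `Tᶜ`. -/
def IsSecludedFree {ι : Type} {Fv : ι → Type} (Gf : ∀ i, SimpleGraph (Fv i)) {V : Type}
    (G : SimpleGraph V) (S T : Set V) (k : ℕ) (C : Set V) : Prop :=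
  (G.induce C).Connected ∧ (∀ i, IsEmpty ((Gf i) ↪g (G.induce C))) ∧
    (openNbhd G C).ncard ≤ k ∧ S ⊆ C ∧ C ⊆ Tᶜ

section Counting

variable {ι : Type} [Fintype ι] {Fv : ι → Type} [∀ i, Fintype (Fv i)]
  {Gf : ∀ i, SimpleGraph (Fv i)} {V : Type} [Fintype V] {G : SimpleGraph V}
  {S₀ T₀ S T : Set V} {k h m : ℕ}

theorem mem_of_seclusionMaximal
    (hh : BoundsProgress Gf G {C | SeclusionMaximal G (IsSecludedFree Gf G S₀ T₀ k) C} S T h)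
    (hm : ∀ i, Fintype.card (Fv i) ≤ m) (hT : T₀ ⊆ T) {w : V} (hw : w ∈ openNbhd G S)
    (hlt : (1 + (2 * m + 2) * m) * h < (membersBetween
      {C | SeclusionMaximal G (IsSecludedFree Gf G S₀ T₀ k) C} (insert w S) T).ncard)
    {C : Set V} (hC : SeclusionMaximal G (IsSecludedFree Gf G S₀ T₀ k) C)
    (hSC : S ⊆ C) (hCT : C ⊆ Tᶜ) : w ∈ C := by
  obtain ⟨C₁, -, hC₁, hC₁T⟩ := exists_mem_membersBetween hlt
  obtain ⟨U, hU⟩ := exists_isClosest G hC₁ hC₁T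
  have hSU : S ⊆ U := (Set.subset_insert w S).trans hU.subset
  have hmin : minNbhd G S T = minNbhd G (insert w S) T :=
    (potential_eq_of_lt hh (Set.subset_insert w S)
      (lt_of_le_of_lt (Nat.le_mul_of_pos_left h (by omega)) hlt)).1
  obtain ⟨⟨hconn, hfree, hk, hS₀C, -⟩, hmax⟩ := hC
  have hfreeU := isEmpty_embedding_union_closest hh hm hU hlt hSC hCT hfree
  obtain ⟨C', hCC', hC'U, hC'conn, hC'⟩ :=
    exists_connected_superset hconn (Set.subset_union_left (t := U))
  have hle : (openNbhd G C').ncard ≤ (openNbhd G C).ncard := by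
    have h₁ := ncard_openNbhd_inter_add_ncard_openNbhd_union_le G C U
    have h₂ := minNbhd_le G (Set.subset_inter hSC hSU) (Set.inter_subset_left.trans hCT)
    have h₃ : (openNbhd G C').ncard ≤ (openNbhd G (C ∪ U)).ncard :=
      Set.ncard_le_ncard fun v hv =>
        ⟨hC' v hv, hv.2.choose, hC'U hv.2.choose_spec.1, hv.2.choose_spec.2⟩
    have h₄ := hU.ncard_eq
    omega
  by_contra hwC
  have heq : C = C' := by
    by_contra hne
    refine absurd (hmax C' (hCC'.ssubset_of_ne hne) ⟨hC'conn, fun i => ⟨fun f => ?_⟩,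
      hle.trans hk, hS₀C.trans hCC', ?_⟩) (by omega)
    · exact (hfreeU i).false (f.trans (SimpleGraph.induceHomOfLE G hC'U))
    · exact (hC'U.trans (Set.union_subset hCT hU.subset_compl)).trans
        (Set.compl_subset_compl.2 hT)
  obtain ⟨-, w', hw', hadj⟩ := hw
  exact hC' w ⟨heq ▸ hwC, w', hCC' (hSC hw'), hadj⟩ (Or.inr (hU.subset (Set.mem_insert w S)))

theorem ncard_membersBetween_le_pow (hm : ∀ i, Fintype.card (Fv i) ≤ m) (d : ℕ) :
    ∀ S T : Set V, S.Nonempty → T₀ ⊆ T →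
      2 * k + Nat.card (Σ i, Set (Fv i)) < potential Gf G S T + d →
      (membersBetween {C | SeclusionMaximal G (IsSecludedFree Gf G S₀ T₀ k) C} S T).ncard ≤
        (2 + (2 * m + 2) * m) ^ d := by
  induction d with
  | zero =>
    intro S T _ _ hpot
    by_contra! hlt
    obtain ⟨C, ⟨⟨-, -, hk, -, -⟩, -⟩, hSC, hCT⟩ := exists_mem_membersBetween hlt
    have h₁ := minNbhd_le G hSC hCT
    have h₂ : (openNbhd G S ∩ T).ncard ≤ (openNbhd G C).ncard :=
      Set.ncard_le_ncard fun v hv =>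
        ⟨fun hvC => hCT hvC hv.2, hv.1.2.choose, hSC hv.1.2.choose_spec.1, hv.1.2.choose_spec.2⟩
    have h₃ := Set.ncard_le_card (shapes Gf G S)
    unfold potential at hpot
    omega
  | succ d ih =>
    intro S T hS hT hpot
    induction hn : Sᶜ.ncard using Nat.strong_induction_on generalizing S with
    | _ n ih' =>
    subst hn
    by_contra! hlt
    have hh : BoundsProgress Gf G {C | SeclusionMaximal G (IsSecludedFree Gf G S₀ T₀ k) C} S T
        ((2 + (2 * m + 2) * m) ^ d) :=
      fun S' T' hS' hT' hp => ih S' T' (hS.mono hS') (hT.trans hT') (by omega)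
    by_cases hN : openNbhd G S ⊆ T
    · refine absurd ((Set.ncard_le_one_iff (Set.toFinite _)).2 ?_) (not_le.2 (lt_of_le_of_lt
        (Nat.one_le_pow (d + 1) (2 + (2 * m + 2) * m) (by omega)) hlt))
      have hone : ∀ C ∈ membersBetween
          {C | SeclusionMaximal G (IsSecludedFree Gf G S₀ T₀ k) C} S T, C = S :=
        fun C hC => eq_of_connected_of_disjoint_openNbhd hC.1.1.1 hS hC.2.1
          fun v hv hvC => hC.2.2 hvC (hN hv)
      intro C C' hC hC'
      rw [hone C hC, hone C' hC']
    · obtain ⟨w, hw, hwT⟩ := Set.not_subset.1 hN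
      obtain ⟨hwS, w', hw', hadj⟩ := id hw
      have hlt' := lt_ncard_insert_of_adj_mem (n := 1 + (2 * m + 2) * m) hh (Set.Subset.refl S)
        (lt_of_eq_of_lt (by ring) hlt) hw' hadj hwT
      obtain ⟨C, -, hC, hCT⟩ := exists_mem_membersBetween hlt'
      have hle := ih' _ (Set.ncard_lt_ncard (compl_lt_compl_iff_lt.2 (Set.ssubset_insert hwS)))
        (insert w S) (Set.insert_nonempty _ _) (hpot.trans_le (Nat.add_le_add_right
          (potential_mono Gf G (Set.subset_insert w S) (Set.Subset.refl T) hC hCT) _)) rfl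
      refine absurd (hlt.trans_le (Set.ncard_le_ncard fun C hC => ?_)) (not_lt.2 hle)
      exact ⟨hC.1, Set.insert_subset (mem_of_seclusionMaximal hh hm hT hw hlt' hC.1 hC.2.1 hC.2.2)
        hC.2.1, hC.2.2⟩

end Counting

theorem stmt0 (ι : Type) [Fintype ι] (Fv : ι → Type) [∀ i, Fintype (Fv i)]
    (Gf : ∀ i, SimpleGraph (Fv i)) :
    ∃ c : ℕ, 2 ≤ c ∧
      ∀ (V : Type) [Fintype V] (G : SimpleGraph V) (S T : Set V) (k : ℕ),
        S.Nonempty → T ⊆ Sᶜ →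
        {C : Set V | SeclusionMaximal G (fun C =>
            (G.induce C).Connected ∧
            (∀ i, IsEmpty ((Gf i) ↪g (G.induce C))) ∧
            (openNbhd G C).ncard ≤ k ∧
            S ⊆ C ∧ C ⊆ Tᶜ) C}.ncard ≤ c ^ (k + 1) := by
  have hm : ∀ i, Fintype.card (Fv i) ≤ ∑ i, Fintype.card (Fv i) := fun i =>
    Finset.single_le_sum (f := fun i => Fintype.card (Fv i)) (fun _ _ => Nat.zero_le _)
      (Finset.mem_univ i)
  set m := ∑ i, Fintype.card (Fv i)
  set M := Nat.card (Σ i, Set (Fv i))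
  refine ⟨(2 + (2 * m + 2) * m) ^ (M + 2), ?_, ?_⟩
  · exact (Nat.le_add_right 2 _).trans (Nat.le_self_pow (by omega) _)
  · intro V _ G S T k hS _
    calc _ ≤ (membersBetween {C | SeclusionMaximal G (IsSecludedFree Gf G S T k) C} S T).ncard :=
          Set.ncard_le_ncard fun C hC => ⟨hC, hC.1.2.2.2.1, hC.1.2.2.2.2⟩
      _ ≤ (2 + (2 * m + 2) * m) ^ (2 * k + M + 1) :=
          ncard_membersBetween_le_pow hm _ S T hS (Set.Subset.refl T) (by omega)
      _ ≤ _ := by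
          rw [← pow_mul]
          exact Nat.pow_le_pow_right (by omega) (by nlinarith)
end

section
/- For every finite set 𝓕 of finite simple graphs there exists a constant c ≥ 2 such that for every finite simple graph G on n vertices and every natural number k, the number of vertex sets C that are seclusion-maximal with respect to the property "G[C] is connected, G[C] is 𝓕-free, and |N_G(C)| ≤ k" is at most c^(k+1) · n. -/
open SimpleGraph

namespace Secluded

section Neighborhood

variable {V : Type} {G : SimpleGraph V}

/-- The number of neighbors of `A` outside `D`. -/
noncomputable def nbhdCard (G : SimpleGraph V) (D A : Set V) : ℕ :=
  (openNbhd G A \ D).ncard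

theorem nbhdCard_submodular [Finite V] (D A B : Set V) :
    nbhdCard G D (A ∪ B) + nbhdCard G D (A ∩ B) ≤ nbhdCard G D A + nbhdCard G D B := by
  unfold nbhdCard
  rw [← Set.ncard_union_add_ncard_inter, ← Set.ncard_union_add_ncard_inter (openNbhd G A \ D)]
  refine add_le_add (Set.ncard_le_ncard ?_) (Set.ncard_le_ncard ?_)
  · rintro v (⟨⟨hv, u, hu, huv⟩, hD⟩ | ⟨⟨hv, u, hu, huv⟩, hD⟩)
    · rcases hu with hu | hu
      · exact Or.inl ⟨⟨fun h => hv (Or.inl h), u, hu, huv⟩, hD⟩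
      · exact Or.inr ⟨⟨fun h => hv (Or.inr h), u, hu, huv⟩, hD⟩
    · by_cases hA : v ∈ A
      · exact Or.inr ⟨⟨fun h => hv ⟨hA, h⟩, u, hu.2, huv⟩, hD⟩
      · exact Or.inl ⟨⟨hA, u, hu.1, huv⟩, hD⟩
  · rintro v ⟨⟨⟨hv, -⟩, hD⟩, ⟨⟨-, u, hu, huv⟩, -⟩⟩
    exact ⟨⟨⟨fun h => hv (Or.inl h), u, hu.1, huv⟩, hD⟩,
      ⟨⟨fun h => hv (Or.inr h), u, hu.2, huv⟩, hD⟩⟩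

theorem nbhdCard_le_insert [Finite V] (D A : Set V) (v : V) :
    nbhdCard G D A ≤ nbhdCard G (insert v D) A + 1 := by
  unfold nbhdCard
  refine le_trans (Set.ncard_le_ncard ?_) (Set.ncard_insert_le v (openNbhd G A \ insert v D))
  intro w hw
  by_cases h : w = v
  · exact Or.inl h
  · exact Or.inr ⟨hw.1, fun hw' => hw'.elim h hw.2⟩

theorem nbhdCard_insert_of_mem [Finite V] {D A : Set V} {v : V} (hv : v ∈ openNbhd G A)
    (hD : v ∉ D) : nbhdCard G (insert v D) A + 1 = nbhdCard G D A := by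
  unfold nbhdCard
  rw [Set.insert_eq, Set.union_comm, ← Set.sdiff_sdiff]
  exact Set.ncard_sdiff_singleton_add_one ⟨hv, hD⟩

theorem nbhdCard_insert_le [Finite V] (D A : Set V) (v : V) :
    nbhdCard G (insert v D) A ≤ nbhdCard G D A :=
  Set.ncard_le_ncard fun _ hw => ⟨hw.1, fun h => hw.2 (Or.inr h)⟩

theorem nbhdCard_add_ncard [Finite V] {D A : Set V} (h : D ⊆ openNbhd G A) :
    nbhdCard G D A + D.ncard = (openNbhd G A).ncard :=
  Set.ncard_sdiff_add_ncard_of_subset h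

/-- A connected set that meets `A` but not its open neighborhood lies in `A`. -/
theorem subset_of_connected {A C : Set V} (hC : (G.induce C).Connected) {s : V} (hsC : s ∈ C)
    (hsA : s ∈ A) (hN : ∀ v ∈ openNbhd G A, v ∉ C) : C ⊆ A := by
  intro v hv
  by_contra hvA
  obtain ⟨p⟩ := hC.preconnected ⟨s, hsC⟩ ⟨v, hv⟩
  obtain ⟨d, -, h1, h2⟩ := p.exists_boundary_dart {x | x.1 ∈ A} hsA hvA
  exact hN d.snd.1 ⟨h2, d.fst.1, h1, d.adj⟩ d.snd.2

/-- The connected part of `U` around `s` contains every connected set `C` with `s ∈ C ⊆ U`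
and has no neighbors other than those of `U`. -/
theorem exists_connected_part (G : SimpleGraph V) {s : V} {U : Set V} (hs : s ∈ U) :
    ∃ A ⊆ U, (G.induce A).Connected ∧ openNbhd G A ⊆ openNbhd G U ∧
      ∀ C ⊆ U, s ∈ C → (G.induce C).Connected → C ⊆ A := by
  let 𝒮 : Set (Set V) := {C | C ⊆ U ∧ s ∈ C ∧ (G.induce C).Connected}
  have hsing : {s} ∈ 𝒮 := by
    refine ⟨by simpa using hs, rfl, ?_⟩
    rw [G.induce_singleton_eq_top s]
    exact SimpleGraph.connected_top
  refine ⟨⋃₀ 𝒮, Set.sUnion_subset fun C hC => hC.1, ?_, ?_, fun C h1 h2 h3 =>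
    Set.subset_sUnion_of_mem ⟨h1, h2, h3⟩⟩
  · exact induce_sUnion_connected_of_pairwise_not_disjoint ⟨_, hsing⟩
      (fun h1 h2 => ⟨s, h1.2.1, h2.2.1⟩) fun h => h.2.2
  · rintro v ⟨hv, u, ⟨C, hC, huC⟩, huv⟩
    refine ⟨fun hvU => hv ?_, u, hC.1 huC, huv⟩
    refine ⟨C ∪ {u, v}, ⟨?_, Or.inl hC.2.1, ?_⟩, by simp⟩
    · rintro w (hw | rfl | rfl)
      exacts [hC.1 hw, hC.1 huC, hvU]
    · exact induce_union_connected hC.2.2.preconnected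
        (induce_pair_connected_of_adj huv).preconnected ⟨u, huC, by simp⟩

end Neighborhood

section Copies

variable {V W : Type}

/-- `f` restricts to an isomorphism from the induced subgraph `H[B]` onto an induced subgraph
of `G[X]`. -/
def IsCopy (H : SimpleGraph W) (G : SimpleGraph V) (B : Set W) (X : Set V) (f : W → V) : Prop :=
  (∀ a ∈ B, f a ∈ X) ∧ Set.InjOn f B ∧ ∀ a ∈ B, ∀ b ∈ B, (G.Adj (f a) (f b) ↔ H.Adj a b)

variable {H : SimpleGraph W} {G : SimpleGraph V}

theorem IsCopy.mono {B : Set W} {X X' : Set V} {f : W → V} (h : IsCopy H G B X f)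
    (hX : X ⊆ X') : IsCopy H G B X' f :=
  ⟨fun a ha => hX (h.1 a ha), h.2⟩

theorem nonempty_embedding_iff {X : Set V} :
    Nonempty (H ↪g G.induce X) ↔ ∃ f, IsCopy H G Set.univ X f := by
  constructor
  · rintro ⟨e⟩
    refine ⟨fun a => (e a).1, fun a _ => (e a).2, fun a _ b _ h => e.injective (Subtype.ext h),
      fun a _ b _ => ?_⟩
    simpa using e.map_rel_iff (a := a) (b := b)
  · rintro ⟨f, h1, h2, h3⟩
    exact ⟨⟨⟨fun a => ⟨f a, h1 a trivial⟩, fun a b h =>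
      h2 trivial trivial (congrArg Subtype.val h)⟩, fun {a b} => h3 a trivial b trivial⟩⟩

/-- A copy of `H` whose part outside `B` is not adjacent to a copy of `H[B]` can have its
`B`-part replaced by that copy. -/
theorem IsCopy.replace {B : Set W} {X X' C : Set V} {f g : W → V}
    (hf : IsCopy H G Set.univ X f) (hg : IsCopy H G B C g) (hgX : ∀ a ∈ B, g a ∈ X')
    (hB : ∀ a, a ∈ B → f a ∈ C) (hB' : ∀ a, a ∉ B → f a ∉ C ∧ f a ∉ openNbhd G C ∧ f a ∈ X') :
    ∃ e, IsCopy H G Set.univ X' e := by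
  classical
  have hcross : ∀ c ∈ C, ∀ a, a ∉ B → ¬ G.Adj c (f a) := fun c hc a ha hadj =>
    (hB' a ha).2.1 ⟨(hB' a ha).1, c, hc, hadj⟩
  refine ⟨fun a => if a ∈ B then g a else f a, fun a _ => ?_, fun a _ b _ hab => ?_,
    fun a _ b _ => ?_⟩
  · by_cases ha : a ∈ B
    · simpa [ha] using hgX a ha
    · simpa [ha] using (hB' a ha).2.2
  · by_cases ha : a ∈ B <;> by_cases hb : b ∈ B <;> simp only [ha, hb, if_true, if_false] at hab
    · exact hg.2.1 ha hb hab
    · exact absurd (hab ▸ hg.1 a ha) (hB' b hb).1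
    · exact absurd (hab ▸ hg.1 b hb) (hB' a ha).1
    · exact hf.2.1 trivial trivial hab
  · by_cases ha : a ∈ B <;> by_cases hb : b ∈ B <;> simp only [ha, hb, if_true, if_false]
    · exact hg.2.2 a ha b hb
    · refine ⟨fun h => absurd h (hcross _ (hg.1 a ha) b hb), fun h => ?_⟩
      exact absurd ((hf.2.2 a trivial b trivial).2 h) (hcross _ (hB a ha) b hb)
    · refine ⟨fun h => absurd h.symm (hcross _ (hg.1 b hb) a ha), fun h => ?_⟩
      exact absurd ((hf.2.2 a trivial b trivial).2 h).symm (hcross _ (hB b hb) a ha)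
    · exact hf.2.2 a trivial b trivial

variable {ι : Type} {Fv : ι → Type}

/-- `G[X]` contains no induced copy of a member of the family `Gf`. -/
def IsFree (Gf : ∀ i, SimpleGraph (Fv i)) (G : SimpleGraph V) (X : Set V) : Prop :=
  ∀ i f, ¬ IsCopy (Gf i) G Set.univ X f

theorem IsFree.mono {Gf : ∀ i, SimpleGraph (Fv i)} {X X' : Set V} (h : IsFree Gf G X')
    (hX : X ⊆ X') : IsFree Gf G X :=
  fun i f hf => h i f (hf.mono hX)

theorem isFree_iff {Gf : ∀ i, SimpleGraph (Fv i)} {X : Set V} :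
    IsFree Gf G X ↔ ∀ i, IsEmpty (Gf i ↪g G.induce X) := by
  simp only [IsFree, ← not_nonempty_iff, nonempty_embedding_iff, not_exists]

/-- The induced subgraphs of members of `Gf` (as pairs of an index and a vertex set) that have a
copy in `G[X]`. -/
def patterns (Gf : ∀ i, SimpleGraph (Fv i)) (G : SimpleGraph V) (X : Set V) :
    Set (Σ i, Set (Fv i)) :=
  {P | ∃ f, IsCopy (Gf P.1) G P.2 X f}

theorem patterns_mono {Gf : ∀ i, SimpleGraph (Fv i)} {X X' : Set V} (h : X ⊆ X') :
    patterns Gf G X ⊆ patterns Gf G X' :=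
  fun _ ⟨f, hf⟩ => ⟨f, hf.mono h⟩

end Copies

section Branching

variable {V ι : Type} {Fv : ι → Type}

/-- A node of the branching tree: the vertices of `S` are in the solution, those of `T` are not,
those of `D` are neighbors of the solution, and `U` is the region explored so far. -/
structure Node (V : Type) where
  S : Set V
  T : Set V
  D : Set V
  U : Set V

namespace Node

/-- The sets extending the explored region that are compatible with the guesses made. -/
structure IsExtension (x : Node V) (W : Set V) : Prop where
  hU : x.U ⊆ W
  hS : x.S ⊆ W
  hT : ∀ v ∈ W, v ∉ x.T
  hD : ∀ v ∈ W, v ∈ x.D → v ∈ x.U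

/-- The least neighborhood size of an extension. -/
noncomputable def sepNumber (G : SimpleGraph V) (x : Node V) : ℕ :=
  sInf (nbhdCard G x.D '' {W | x.IsExtension W})

/-- `W` is an extension of least neighborhood size. -/
def IsMinimizer (G : SimpleGraph V) (x : Node V) (W : Set V) : Prop :=
  x.IsExtension W ∧ nbhdCard G x.D W = x.sepNumber G

variable {G : SimpleGraph V} {x y : Node V}

theorem sepNumber_le {W : Set V} (h : x.IsExtension W) : x.sepNumber G ≤ nbhdCard G x.D W :=
  Nat.sInf_le ⟨W, h, rfl⟩

theorem exists_isMinimizer {W : Set V} (h : x.IsExtension W) : ∃ W, x.IsMinimizer G W := by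
  obtain ⟨W', h1, h2⟩ := Nat.sInf_mem (⟨_, W, h, rfl⟩ :
    (nbhdCard G x.D '' {W | x.IsExtension W}).Nonempty)
  exact ⟨W', h1, h2⟩

/-- The minimizers of least cardinality lie in every minimizer. -/
theorem exists_least_isMinimizer [Finite V] {W : Set V} (h : x.IsExtension W) :
    ∃ W, x.IsMinimizer G W ∧ ∀ W', x.IsMinimizer G W' → W ⊆ W' := by
  obtain ⟨W₁, hW₁⟩ := exists_isMinimizer (G := G) h
  obtain ⟨W, hW⟩ := (Set.toFinite {W | x.IsMinimizer G W}).exists_minimal ⟨W₁, hW₁⟩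
  refine ⟨W, hW.prop, fun W' hW' => ?_⟩
  have hu : x.IsExtension (W ∪ W') :=
    ⟨fun v hv => Or.inl (hW.prop.1.hU hv), fun v hv => Or.inl (hW.prop.1.hS hv),
      fun v hv => hv.elim (hW.prop.1.hT v) (hW'.1.hT v),
      fun v hv => hv.elim (hW.prop.1.hD v) (hW'.1.hD v)⟩
  have hi : x.IsExtension (W ∩ W') :=
    ⟨fun v hv => ⟨hW.prop.1.hU hv, hW'.1.hU hv⟩, fun v hv => ⟨hW.prop.1.hS hv, hW'.1.hS hv⟩,
      fun v hv => hW.prop.1.hT v hv.1, fun v hv => hW.prop.1.hD v hv.1⟩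
  have h1 := sepNumber_le (G := G) hu
  have h2 := sepNumber_le (G := G) hi
  have h3 := nbhdCard_submodular (G := G) x.D W W'
  have h4 := hW.prop.2
  have h5 := hW'.2
  exact (hW.le_of_le (y := W ∩ W') ⟨hi, by omega⟩ Set.inter_subset_left).trans
    Set.inter_subset_right

variable (Gf : ∀ i, SimpleGraph (Fv i))

open scoped Classical in
/-- Whether no minimizer is free of the forbidden graphs. -/
noncomputable def obstructed (G : SimpleGraph V) (x : Node V) : ℕ :=
  if ∃ W, x.IsMinimizer G W ∧ IsFree Gf G (W \ x.D) then 0 else 1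

/-- The progress measure of the branching. -/
noncomputable def progress (G : SimpleGraph V) (k : ℕ) (x : Node V) : ℕ :=
  4 * x.D.ncard + 2 * x.sepNumber G + x.obstructed Gf G + (openNbhd G x.U ∩ x.T).ncard +
    (patterns Gf G (x.S ∩ x.U)).ncard * (4 * k + 2)

/-- `C` is a solution compatible with the guesses made at the node `x`. -/
structure Compat (G : SimpleGraph V) (𝓜 : Set (Set V)) (Y : Set V) (s : V) (x : Node V)
    (C : Set V) : Prop where
  mem : C ∈ 𝓜
  hs : s ∈ x.S
  hS : x.S ⊆ C
  hD : x.D ⊆ openNbhd G C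
  hT : ∀ v ∈ x.T, v ∉ C
  hUT : ∀ v ∈ x.U, v ∉ x.T
  hY : ∀ v, v ∉ Y → v ∈ x.T
  free : IsFree Gf G (x.U \ x.D)
  card : nbhdCard G x.D (C ∪ x.U) ≤ nbhdCard G x.D C + (x.D ∩ x.U).ncard
  disj : IsEmpty ι → ∀ v ∈ x.D, v ∉ x.U

variable {Gf} {𝓜 : Set (Set V)} {Y : Set V} {s : V} {C : Set V}

theorem Compat.isExtension (h : x.Compat Gf G 𝓜 Y s C) : x.IsExtension (C ∪ x.U) where
  hU := Set.subset_union_right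
  hS := h.hS.trans Set.subset_union_left
  hT _ hv hvT := hv.elim (h.hT _ hvT) fun hU => h.hUT _ hU hvT
  hD _ hv hvD := hv.elim (fun hC => absurd hC (h.hD hvD).1) id

theorem obstructed_le : x.obstructed Gf G ≤ 1 := by
  unfold obstructed
  split_ifs <;> simp

theorem Compat.progress_le [Finite V] [Finite ι] [∀ i, Finite (Fv i)] {k : ℕ}
    (h : x.Compat Gf G 𝓜 Y s C) (hk : (openNbhd G C).ncard ≤ k) :
    2 * x.sepNumber G + x.obstructed Gf G + (openNbhd G x.U ∩ x.T).ncard ≤ 4 * k + 1 ∧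
      x.progress Gf G k ≤ 8 * k + 1 + Nat.card (Σ i, Set (Fv i)) * (4 * k + 2) := by
  have h1 := sepNumber_le (G := G) h.isExtension
  have h2 := h.card
  have h3 := nbhdCard_add_ncard h.hD
  have h4 : (x.D ∩ x.U).ncard ≤ x.D.ncard := Set.ncard_le_ncard Set.inter_subset_left
  have h5 : (openNbhd G x.U ∩ x.T).ncard ≤ nbhdCard G x.D (C ∪ x.U) + x.D.ncard := by
    refine (Set.ncard_le_ncard ?_).trans (Set.ncard_le_ncard_sdiff_add_ncard _ x.D)
    rintro v ⟨⟨hv, u, hu, huv⟩, hvT⟩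
    exact ⟨fun h' => h'.elim (h.hT v hvT) hv, u, Or.inr hu, huv⟩
  have h6 := obstructed_le (Gf := Gf) (G := G) (x := x)
  have h7 : (patterns Gf G (x.S ∩ x.U)).ncard ≤ Nat.card (Σ i, Set (Fv i)) :=
    Set.ncard_le_card _
  have h8 := Nat.mul_le_mul_right (4 * k + 2) h7
  unfold progress
  omega

/-- Extending the explored region to a free minimizer. -/
theorem Compat.extend [Finite V] (h : x.Compat Gf G 𝓜 Y s C) {W : Set V}
    (hW : x.IsMinimizer G W) (hf : IsFree Gf G (W \ x.D)) :
    ({x with U := W} : Node V).Compat Gf G 𝓜 Y s C where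
  mem := h.mem
  hs := h.hs
  hS := h.hS
  hD := h.hD
  hT := h.hT
  hUT := hW.1.hT
  hY := h.hY
  free := hf
  disj he v hv hvW := h.disj he v hv (hW.1.hD v hvW hv)
  card := by
    have hx := h.isExtension
    have h1 := nbhdCard_submodular (G := G) x.D (C ∪ x.U) W
    have h2 : x.IsExtension ((C ∪ x.U) ∩ W) :=
      ⟨Set.subset_inter hx.hU hW.1.hU, Set.subset_inter hx.hS hW.1.hS,
        fun v hv => hW.1.hT v hv.2, fun v hv => hW.1.hD v hv.2⟩
    have h3 := sepNumber_le (G := G) h2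
    have h4 : C ∪ x.U ∪ W = C ∪ W := by
      rw [Set.union_assoc, Set.union_eq_self_of_subset_left hW.1.hU]
    have h5 : x.D ∩ W = x.D ∩ x.U := by
      ext v
      exact ⟨fun hv => ⟨hv.1, hW.1.hD v hv.2 hv.1⟩, fun hv => ⟨hv.1, hW.1.hU hv.2⟩⟩
    have h6 := hW.2
    have h7 := h.card
    rw [h4] at h1
    simp only [h5]
    omega

theorem Compat.insert_S (h : x.Compat Gf G 𝓜 Y s C) {p : V} (hp : p ∈ C) :
    ({x with S := insert p x.S} : Node V).Compat Gf G 𝓜 Y s C :=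
  { h with hs := Or.inr h.hs, hS := Set.insert_subset hp h.hS }

theorem Compat.insert_T (h : x.Compat Gf G 𝓜 Y s C) {p : V} (hp : p ∉ C) (hpU : p ∉ x.U) :
    ({x with T := insert p x.T} : Node V).Compat Gf G 𝓜 Y s C :=
  { h with
    hT := by
      rintro v (rfl | hv)
      exacts [hp, h.hT v hv]
    hUT := by
      rintro v hv (rfl | hv')
      exacts [hpU hv, h.hUT v hv hv']
    hY := fun v hv => Or.inr (h.hY v hv) }

theorem Compat.insert_D [Finite V] (h : x.Compat Gf G 𝓜 Y s C) {p : V} (hp : p ∈ openNbhd G C)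
    (hpD : p ∉ x.D) (he : IsEmpty ι → p ∉ x.U) :
    ({x with D := insert p x.D} : Node V).Compat Gf G 𝓜 Y s C :=
  { h with
    hD := Set.insert_subset hp h.hD
    free := h.free.mono fun v hv => ⟨hv.1, fun hv' => hv.2 (Or.inr hv')⟩
    disj := by
      rintro hι v (rfl | hv)
      exacts [he hι, h.disj hι v hv]
    card := by
      have h1 := nbhdCard_insert_of_mem hp hpD
      have h2 := h.card
      simp only
      by_cases hpU : p ∈ x.U
      · have h3 := nbhdCard_insert_le (G := G) x.D (C ∪ x.U) p
        rw [Set.insert_inter_of_mem hpU, Set.ncard_insert_of_notMem fun hp' => hpD hp'.1]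
        omega
      · have h3 : p ∈ openNbhd G (C ∪ x.U) := by
          obtain ⟨hpC, u, hu, hup⟩ := hp
          exact ⟨fun hp' => hp'.elim hpC hpU, u, Or.inl hu, hup⟩
        have h4 := nbhdCard_insert_of_mem h3 hpD
        rw [Set.insert_inter_of_notMem hpU]
        omega }

/-- Discarding the explored region after learning that a set `B` is part of the solution. -/
theorem Compat.restart (h : x.Compat Gf G 𝓜 Y s C) {B : Set V} (hB : B ⊆ C)
    (hC : IsFree Gf G C) :
    ({x with S := x.S ∪ B, U := x.S ∪ B} : Node V).Compat Gf G 𝓜 Y s C where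
  mem := h.mem
  hs := Or.inl h.hs
  hS := Set.union_subset h.hS hB
  hD := h.hD
  hT := h.hT
  hUT v hv hvT := h.hT v hvT (Set.union_subset h.hS hB hv)
  hY := h.hY
  free := hC.mono (Set.sdiff_subset.trans (Set.union_subset h.hS hB))
  disj _ v hv hvU := (h.hD hv).1 (Set.union_subset h.hS hB hvU)
  card := by
    simp only [Set.union_eq_self_of_subset_right (Set.union_subset h.hS hB)]
    exact Nat.le_add_right _ _

theorem sepNumber_le_add {W₀ : Set V} (hy : y.IsExtension W₀) (c : ℕ)
    (h : ∀ W, y.IsExtension W → x.IsExtension W ∧ nbhdCard G x.D W ≤ nbhdCard G y.D W + c) :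
    x.sepNumber G ≤ y.sepNumber G + c := by
  obtain ⟨W, hW, hW'⟩ := exists_isMinimizer (G := G) hy
  have h1 := sepNumber_le (G := G) (h W hW).1
  have h2 := (h W hW).2
  omega

theorem sepNumber_le_insert_S {W₀ : Set V} {p : V}
    (hy : ({x with S := insert p x.S} : Node V).IsExtension W₀) :
    x.sepNumber G ≤ ({x with S := insert p x.S} : Node V).sepNumber G :=
  sepNumber_le_add hy 0 fun _ hW =>
    ⟨⟨hW.hU, (Set.subset_insert _ _).trans hW.hS, hW.hT, hW.hD⟩, le_rfl⟩

theorem sepNumber_le_insert_T {W₀ : Set V} {p : V}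
    (hy : ({x with T := insert p x.T} : Node V).IsExtension W₀) :
    x.sepNumber G ≤ ({x with T := insert p x.T} : Node V).sepNumber G :=
  sepNumber_le_add hy 0 fun _ hW =>
    ⟨⟨hW.hU, hW.hS, fun v hv hvT => hW.hT v hv (Or.inr hvT), hW.hD⟩, le_rfl⟩

theorem sepNumber_le_insert_D [Finite V] {W₀ : Set V} {p : V}
    (hy : ({x with D := insert p x.D} : Node V).IsExtension W₀) :
    x.sepNumber G ≤ ({x with D := insert p x.D} : Node V).sepNumber G + 1 :=
  sepNumber_le_add hy 1 fun W hW =>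
    ⟨⟨hW.hU, hW.hS, hW.hT, fun v hv hvD => hW.hD v hv (Or.inr hvD)⟩,
      nbhdCard_le_insert x.D W p⟩

theorem progress_lt_insert_D [Finite V] {k : ℕ} {W₀ : Set V} {p : V} (hpD : p ∉ x.D)
    (hy : ({x with D := insert p x.D} : Node V).IsExtension W₀) :
    x.progress Gf G k < ({x with D := insert p x.D} : Node V).progress Gf G k := by
  have h1 := sepNumber_le_insert_D (G := G) hy
  have h2 := Set.ncard_insert_of_notMem hpD
  have h3 := obstructed_le (Gf := Gf) (G := G) (x := x)
  unfold progress
  simp only at *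
  omega

/-- Forbidding a vertex of the least minimizer increases the separation number. -/
theorem progress_lt_insert_T_of_least [Finite V] {k : ℕ} {W W₀ : Set V} {p : V}
    (hW : ∀ W', x.IsMinimizer G W' → W ⊆ W') (hp : p ∈ W)
    (hy : ({x with T := insert p x.T} : Node V).IsExtension W₀) :
    x.progress Gf G k < ({x with T := insert p x.T} : Node V).progress Gf G k := by
  have h1 := sepNumber_le_insert_T (G := G) hy
  have h2 : x.sepNumber G ≠ ({x with T := insert p x.T} : Node V).sepNumber G := by
    intro heq
    obtain ⟨W', hW'⟩ := exists_isMinimizer (G := G) hy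
    refine hW'.1.hT p (hW W' ⟨⟨hW'.1.hU, hW'.1.hS,
      fun v hv hvT => hW'.1.hT v hv (Or.inr hvT), hW'.1.hD⟩, ?_⟩ hp) (Or.inl rfl)
    rw [heq]
    exact hW'.2
  have h3 := obstructed_le (Gf := Gf) (G := G) (x := x)
  have h4 : (openNbhd G x.U ∩ x.T).ncard ≤ (openNbhd G x.U ∩ insert p x.T).ncard :=
    Set.ncard_le_ncard fun v hv => ⟨hv.1, Or.inr hv.2⟩
  unfold progress
  simp only at *
  omega

theorem obstructed_eq_zero {W : Set V} (hW : x.IsMinimizer G W) (hf : IsFree Gf G (W \ x.D)) :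
    x.obstructed Gf G = 0 :=
  if_pos ⟨W, hW, hf⟩

/-- Forbidding a neighbor of the explored region. -/
theorem progress_lt_insert_T_of_mem [Finite V] {k : ℕ} {W₀ : Set V} {p : V}
    (h0 : x.obstructed Gf G = 0) (hp : p ∈ openNbhd G x.U) (hpT : p ∉ x.T)
    (hy : ({x with T := insert p x.T} : Node V).IsExtension W₀) :
    x.progress Gf G k < ({x with T := insert p x.T} : Node V).progress Gf G k := by
  have h1 := sepNumber_le_insert_T (G := G) hy
  have h2 : (openNbhd G x.U ∩ insert p x.T).ncard = (openNbhd G x.U ∩ x.T).ncard + 1 := by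
    rw [Set.inter_insert_of_mem hp, Set.ncard_insert_of_notMem fun h => hpT h.2]
  unfold progress
  simp only at *
  omega

/-- Adding a vertex outside a maximal free minimizer to the solution. -/
theorem progress_lt_insert_S [Finite V] [Finite ι] [∀ i, Finite (Fv i)] {k : ℕ} {W₀ : Set V}
    {p : V} (h0 : x.obstructed Gf G = 0)
    (hmax : ∀ W, x.IsMinimizer G W → IsFree Gf G (W \ x.D) → p ∉ W)
    (hy : ({x with S := insert p x.S} : Node V).IsExtension W₀) :
    x.progress Gf G k < ({x with S := insert p x.S} : Node V).progress Gf G k := by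
  have h1 := sepNumber_le_insert_S (G := G) hy
  have h2 : x.sepNumber G = ({x with S := insert p x.S} : Node V).sepNumber G →
      ({x with S := insert p x.S} : Node V).obstructed Gf G = 1 := by
    refine fun heq => if_neg ?_
    rintro ⟨W, hW, hf⟩
    refine hmax W ⟨⟨hW.1.hU, (Set.subset_insert _ _).trans hW.1.hS, hW.1.hT, hW.1.hD⟩, ?_⟩ hf
      (hW.1.hS (Or.inl rfl))
    rw [heq]
    exact hW.2
  have h3 : (patterns Gf G (x.S ∩ x.U)).ncard ≤
      (patterns Gf G (insert p x.S ∩ x.U)).ncard :=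
    Set.ncard_le_ncard (patterns_mono fun v hv => ⟨Or.inr hv.1, hv.2⟩)
  have h4 := Nat.mul_le_mul_right (4 * k + 2) h3
  unfold progress
  simp only at *
  omega

theorem Compat.progress_lt_restart [Finite V] [Finite ι] [∀ i, Finite (Fv i)] {k : ℕ}
    (h : x.Compat Gf G 𝓜 Y s C) (hk : (openNbhd G C).ncard ≤ k) {B : Set V}
    {P : Σ i, Set (Fv i)} (hP : P ∈ patterns Gf G B) (hP' : P ∉ patterns Gf G (x.S ∩ x.U)) :
    x.progress Gf G k <
      ({x with S := x.S ∪ B, U := x.S ∪ B} : Node V).progress Gf G k := by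
  have h1 := (h.progress_le hk).1
  have h2 : (patterns Gf G (x.S ∩ x.U)).ncard + 1 ≤
      (patterns Gf G ((x.S ∪ B) ∩ (x.S ∪ B))).ncard := by
    rw [← Set.ncard_insert_of_notMem hP', Set.inter_self]
    exact Set.ncard_le_ncard (Set.insert_subset (patterns_mono Set.subset_union_right hP)
      (patterns_mono fun v hv => Or.inl hv.1))
  have h4 := Nat.mul_le_mul_right (4 * k + 2) h2
  unfold progress
  simp only at *
  rw [add_mul] at h4
  omega

/-- The number of children of a node of the branching tree. -/
noncomputable def arity (Fv : ι → Type) : ℕ :=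
  Nat.card (Fin 3 ⊕ Σ i, (Fv i ⊕ Fv i ⊕ Set (Fv i)))

variable {k : ℕ}

theorem branch_obstructed [Finite V] [Finite ι] [∀ i, Finite (Fv i)]
    (h𝓜 : ∀ C ∈ 𝓜, IsFree Gf G C ∧ (openNbhd G C).ncard ≤ k)
    (hne : ∃ C, x.Compat Gf G 𝓜 Y s C)
    (hx : ¬ ∃ W, x.IsMinimizer G W ∧ IsFree Gf G (W \ x.D)) :
    ∃ (κ : Type) (_ : Finite κ), Nat.card κ ≤ arity Fv ∧ ∃ z : κ → Node V,
      ∀ C, x.Compat Gf G 𝓜 Y s C →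
        ∃ j, (z j).Compat Gf G 𝓜 Y s C ∧ x.progress Gf G k < (z j).progress Gf G k := by
  obtain ⟨C₀, hC₀⟩ := hne
  obtain ⟨W, hW, hleast⟩ := exists_least_isMinimizer (G := G) hC₀.isExtension
  obtain ⟨i, f, hf⟩ : ∃ i f, IsCopy (Gf i) G Set.univ (W \ x.D) f := by
    by_contra hcon
    exact hx ⟨W, hW, fun i f hf => hcon ⟨i, f, hf⟩⟩
  refine ⟨Fv i ⊕ Fv i ⊕ Set (Fv i), inferInstance,
    Nat.card_le_card_of_injective (fun j => Sum.inr ⟨i, j⟩)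
      (Sum.inr_injective.comp sigma_mk_injective),
    Sum.elim (fun a => {x with D := insert (f a) x.D})
      (Sum.elim (fun a => {x with T := insert (f a) x.T})
        fun B => {x with S := x.S ∪ f '' B, U := x.S ∪ f '' B}), fun C hC => ?_⟩
  obtain ⟨hfree, hk⟩ := h𝓜 C hC.mem
  by_cases h1 : ∃ a, f a ∈ openNbhd G C
  · obtain ⟨a, ha⟩ := h1
    have haD : f a ∉ x.D := (hf.1 a trivial).2
    have hc := hC.insert_D ha haD fun hι => hι.elim i
    exact ⟨Sum.inl a, hc, progress_lt_insert_D haD hc.isExtension⟩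
  by_cases h2 : ∃ a, f a ∉ C ∧ f a ∉ x.U
  · obtain ⟨a, haC, haU⟩ := h2
    have hc := hC.insert_T haC haU
    exact ⟨Sum.inr (Sum.inl a), hc,
      progress_lt_insert_T_of_least hleast (hf.1 a trivial).1 hc.isExtension⟩
  push Not at h1 h2
  have hB : f '' {a | f a ∈ C} ⊆ C := Set.image_subset_iff.2 fun a ha => ha
  refine ⟨Sum.inr (Sum.inr {a | f a ∈ C}), hC.restart hB hfree,
    hC.progress_lt_restart hk (P := ⟨i, {a | f a ∈ C}⟩)
      ⟨f, fun a ha => ⟨a, ha, rfl⟩, hf.2.1.mono (Set.subset_univ _),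
        fun a _ b _ => hf.2.2 a trivial b trivial⟩ ?_⟩
  rintro ⟨g, hg⟩
  obtain ⟨e, he⟩ := hf.replace (X' := x.U \ x.D)
    (hg.mono (Set.inter_subset_left.trans hC.hS))
    (fun a ha => ⟨(hg.1 a ha).2, fun hD => (hC.hD hD).1 (hC.hS (hg.1 a ha).1)⟩)
    (fun a ha => ha) fun a ha => ⟨ha, h1 a, h2 a ha, (hf.1 a trivial).2⟩
  exact hC.free i e he

theorem progress_le_extend [Finite V] [Finite ι] [∀ i, Finite (Fv i)] {W : Set V}
    (hW : x.IsMinimizer G W) (hf : IsFree Gf G (W \ x.D)) :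
    ({x with U := W} : Node V).sepNumber G = x.sepNumber G ∧
      ({x with U := W} : Node V).obstructed Gf G = 0 ∧
      x.progress Gf G k ≤ ({x with U := W} : Node V).progress Gf G k := by
  have hW' : ({x with U := W} : Node V).IsExtension W :=
    ⟨subset_rfl, hW.1.hS, hW.1.hT, fun v hv _ => hv⟩
  have h1 : x.sepNumber G ≤ ({x with U := W} : Node V).sepNumber G :=
    sepNumber_le_add hW' 0 fun W' h => ⟨⟨hW.1.hU.trans h.hU, h.hS, h.hT,
      fun v hv hvD => hW.1.hD v (h.hD v hv hvD) hvD⟩, le_rfl⟩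
  have h2 := sepNumber_le (G := G) hW'
  have h3 := hW.2
  have h4 : ({x with U := W} : Node V).sepNumber G = x.sepNumber G := by
    simp only at *
    omega
  have h5 : ({x with U := W} : Node V).obstructed Gf G = 0 :=
    obstructed_eq_zero (W := W) ⟨hW', by rw [h4]; exact h3⟩ hf
  have h6 : x.obstructed Gf G = 0 := obstructed_eq_zero hW hf
  have h7 : (openNbhd G x.U ∩ x.T).ncard ≤ (openNbhd G W ∩ x.T).ncard := by
    refine Set.ncard_le_ncard ?_
    rintro v ⟨⟨-, u, hu, huv⟩, hvT⟩
    exact ⟨⟨fun hv => hW.1.hT v hv hvT, u, hW.1.hU hu, huv⟩, hvT⟩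
  have h8 : (patterns Gf G (x.S ∩ x.U)).ncard ≤ (patterns Gf G (x.S ∩ W)).ncard :=
    Set.ncard_le_ncard (patterns_mono (Set.inter_subset_inter_right _ hW.1.hU))
  have h9 := Nat.mul_le_mul_right (4 * k + 2) h8
  refine ⟨h4, h5, ?_⟩
  unfold progress
  simp only at *
  omega

theorem three_le_arity [Finite ι] [∀ i, Finite (Fv i)] : 3 ≤ arity Fv := by
  simp [arity]

theorem branch_free [Finite V] [Finite ι] [∀ i, Finite (Fv i)]
    (h𝓜 : ∀ C ∈ 𝓜, (G.induce C).Connected)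
    (hx : ∃ W, x.IsMinimizer G W ∧ IsFree Gf G (W \ x.D)) :
    (∃ z : Node V, ∀ C, x.Compat Gf G 𝓜 Y s C → z.Compat Gf G 𝓜 Y s C ∧ C ⊆ z.U) ∨
    ∃ (κ : Type) (_ : Finite κ), Nat.card κ ≤ arity Fv ∧ ∃ z : κ → Node V,
      ∀ C, x.Compat Gf G 𝓜 Y s C →
        ∃ j, (z j).Compat Gf G 𝓜 Y s C ∧ x.progress Gf G k < (z j).progress Gf G k := by
  obtain ⟨W, hWmax⟩ := (Set.toFinite
    {W | x.IsMinimizer G W ∧ IsFree Gf G (W \ x.D)}).exists_maximal hx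
  obtain ⟨hW, hf⟩ := hWmax.prop
  set y : Node V := {x with U := W} with hy
  obtain ⟨hsep, hobs, hprog⟩ := progress_le_extend (k := k) hW hf
  rw [← hy] at hsep hobs hprog
  have hcompat : ∀ C, x.Compat Gf G 𝓜 Y s C → y.Compat Gf G 𝓜 Y s C := fun C hC =>
    hC.extend hW hf
  by_cases hp : ∃ p ∈ openNbhd G W, p ∉ x.T ∧ p ∉ x.D
  · obtain ⟨p, hpW, hpT, hpD⟩ := hp
    refine Or.inr ⟨Fin 3, inferInstance, by simpa using three_le_arity, ![{y with S := insert p y.S},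
      {y with D := insert p y.D}, {y with T := insert p y.T}], fun C hC => ?_⟩
    have hC' := hcompat C hC
    by_cases hpC : p ∈ C
    · have hc := hC'.insert_S hpC
      refine ⟨0, hc, hprog.trans_lt (progress_lt_insert_S hobs (fun W' hW' hf' hpW' => ?_)
        hc.isExtension)⟩
      refine hpW.1 (hWmax.le_of_ge (y := W') ⟨⟨⟨hW.1.hU.trans hW'.1.hU, hW'.1.hS, hW'.1.hT,
        fun v hv hvD => hW.1.hD v (hW'.1.hD v hv hvD) hvD⟩, ?_⟩, hf'⟩ hW'.1.hU hpW')
      rw [← hsep]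
      exact hW'.2
    by_cases hpN : p ∈ openNbhd G C
    · have hc := hC'.insert_D hpN hpD fun _ => hpW.1
      exact ⟨1, hc, hprog.trans_lt (progress_lt_insert_D hpD hc.isExtension)⟩
    · have hc := hC'.insert_T hpC hpW.1
      exact ⟨2, hc, hprog.trans_lt (progress_lt_insert_T_of_mem hobs hpW hpT hc.isExtension)⟩
  · push Not at hp
    refine Or.inl ⟨y, fun C hC => ⟨hcompat C hC, ?_⟩⟩
    refine subset_of_connected (h𝓜 C hC.mem) (hC.hS hC.hs) (hW.1.hS hC.hs) fun v hv hvC => ?_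
    exact (hC.hD (hp v hv fun hvT => hC.hT v hvT hvC)).1 hvC

/-- The solutions that may remain at a leaf of the branching tree. -/
def leafFamily (G : SimpleGraph V) (𝓜 : Set (Set V)) (D U : Set V) : Set (Set V) :=
  {C ∈ 𝓜 | C ⊆ U ∧ D ⊆ openNbhd G C ∧ nbhdCard G D U ≤ nbhdCard G D C + (D ∩ U).ncard}

theorem ncard_compat_le [Finite V] [Finite ι] [∀ i, Finite (Fv i)] {K : ℕ}
    (h𝓜 : ∀ C ∈ 𝓜, (G.induce C).Connected ∧ IsFree Gf G C ∧ (openNbhd G C).ncard ≤ k)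
    (hK : ∀ D U, IsFree Gf G (U \ D) → U ⊆ Y → (IsEmpty ι → ∀ v ∈ D, v ∉ U) →
      (leafFamily G 𝓜 D U).ncard ≤ K) (m : ℕ) :
    ∀ x : Node V,
      8 * k + 1 + Nat.card (Σ i, Set (Fv i)) * (4 * k + 2) < x.progress Gf G k + m →
      {C | x.Compat Gf G 𝓜 Y s C}.ncard ≤ arity Fv ^ m * K := by
  induction m with
  | zero =>
    intro x hx
    have : {C | x.Compat Gf G 𝓜 Y s C} = ∅ := by
      refine Set.eq_empty_of_forall_notMem fun C hC => ?_
      have := (Compat.progress_le hC (h𝓜 C hC.mem).2.2).2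
      omega
    simp [this]
  | succ m ih =>
    intro x hx
    by_cases hne : ∃ C, x.Compat Gf G 𝓜 Y s C
    swap
    · simp only [not_exists] at hne
      simp [hne]
    have hbranch : (∃ z : Node V, ∀ C, x.Compat Gf G 𝓜 Y s C →
        z.Compat Gf G 𝓜 Y s C ∧ C ⊆ z.U) ∨
        ∃ (κ : Type) (_ : Finite κ), Nat.card κ ≤ arity Fv ∧ ∃ z : κ → Node V,
          ∀ C, x.Compat Gf G 𝓜 Y s C →
            ∃ j, (z j).Compat Gf G 𝓜 Y s C ∧ x.progress Gf G k < (z j).progress Gf G k := by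
      by_cases hfree : ∃ W, x.IsMinimizer G W ∧ IsFree Gf G (W \ x.D)
      · exact branch_free (fun C hC => (h𝓜 C hC).1) hfree
      · exact Or.inr (branch_obstructed (fun C hC => (h𝓜 C hC).2) hne hfree)
    rcases hbranch with ⟨z, hz⟩ | ⟨κ, _, hκ, z, hz⟩
    · obtain ⟨C₀, hC₀⟩ := hne
      have hz₀ := (hz C₀ hC₀).1
      have hsub : {C | x.Compat Gf G 𝓜 Y s C} ⊆ leafFamily G 𝓜 z.D z.U := by
        intro C hC
        obtain ⟨h1, h2⟩ := hz C hC
        refine ⟨h1.mem, h2, h1.hD, ?_⟩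
        have h3 := h1.card
        rwa [Set.union_eq_self_of_subset_left h2] at h3
      refine (Set.ncard_le_ncard hsub).trans ((hK z.D z.U hz₀.free (fun v hv => ?_)
        hz₀.disj).trans (Nat.le_mul_of_pos_left _ (pow_pos ?_ _)))
      · by_contra hvY
        exact hz₀.hUT v hv (hz₀.hY v hvY)
      · have := three_le_arity (Fv := Fv)
        omega
    · have : Fintype κ := Fintype.ofFinite κ
      let 𝒳 : κ → Set (Set V) := fun j =>
        {C | (z j).Compat Gf G 𝓜 Y s C ∧ x.progress Gf G k < (z j).progress Gf G k}
      have hsub : {C | x.Compat Gf G 𝓜 Y s C} ⊆ ⋃ j, 𝒳 j := fun C hC =>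
        Set.mem_iUnion.2 (hz C hC)
      have hj : ∀ j, (𝒳 j).ncard ≤ arity Fv ^ m * K := by
        intro j
        by_cases hlt : x.progress Gf G k < (z j).progress Gf G k
        · exact (Set.ncard_le_ncard fun C hC => hC.1).trans (ih (z j) (by omega))
        · simp [𝒳, hlt]
      calc _ ≤ (⋃ j, 𝒳 j).ncard := Set.ncard_le_ncard hsub
        _ ≤ ∑ j, (𝒳 j).ncard := Set.ncard_iUnion_le_of_fintype _
        _ ≤ ∑ _j : κ, arity Fv ^ m * K := Finset.sum_le_sum fun j _ => hj j
        _ = Nat.card κ * (arity Fv ^ m * K) := by simp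
        _ ≤ arity Fv * (arity Fv ^ m * K) := Nat.mul_le_mul_right _ hκ
        _ = arity Fv ^ (m + 1) * K := by ring

end Node

open Node

/-- The exponent of the branching bound. -/
noncomputable def exponent (Fv : ι → Type) : ℕ :=
  8 + 4 * Nat.card (Σ i, Set (Fv i))

variable {Gf : ∀ i, SimpleGraph (Fv i)} {G : SimpleGraph V} {𝓜 : Set (Set V)} {Y : Set V}
  {k K : ℕ}

theorem ncard_le_of_leafFamily [Finite V] [Finite ι] [∀ i, Finite (Fv i)] {s : V}
    (h𝓜 : ∀ C ∈ 𝓜, (G.induce C).Connected ∧ IsFree Gf G C ∧ (openNbhd G C).ncard ≤ k)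
    (hs : ∀ C ∈ 𝓜, s ∈ C) (hY : ∀ C ∈ 𝓜, C ⊆ Y)
    (hK : ∀ D U, IsFree Gf G (U \ D) → U ⊆ Y → (IsEmpty ι → ∀ v ∈ D, v ∉ U) →
      (leafFamily G 𝓜 D U).ncard ≤ K) :
    𝓜.ncard ≤ (arity Fv ^ exponent Fv) ^ (k + 1) * K := by
  have hsub : 𝓜 ⊆ {C | (⟨{s}, Yᶜ, ∅, {s}⟩ : Node V).Compat Gf G 𝓜 Y s C} := by
    intro C hC
    exact
      { mem := hC
        hs := rfl
        hS := Set.singleton_subset_iff.2 (hs C hC)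
        hD := Set.empty_subset _
        hT := fun v hv hvC => hv (hY C hC hvC)
        hUT := fun v hv hvT => hvT (hY C hC (by rw [Set.mem_singleton_iff.1 hv]; exact hs C hC))
        hY := fun v hv => hv
        free := (h𝓜 C hC).2.1.mono
          (Set.sdiff_subset.trans (Set.singleton_subset_iff.2 (hs C hC)))
        card := by
          simp only [Set.union_eq_self_of_subset_right (Set.singleton_subset_iff.2 (hs C hC))]
          exact Nat.le_add_right _ _
        disj := fun _ v hv => absurd hv (Set.notMem_empty v) }
  rw [← pow_mul]
  refine (Set.ncard_le_ncard hsub).trans (ncard_compat_le h𝓜 hK _ _ ?_)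
  have : 8 * k + 1 + Nat.card (Σ i, Set (Fv i)) * (4 * k + 2) <
      exponent Fv * (k + 1) := by
    unfold exponent
    nlinarith [Nat.zero_le (Nat.card (Σ i, Set (Fv i)))]
  omega

end Branching

theorem ncard_le_of_subset {V ι : Type} [Finite V] {Fv : ι → Type}
    {Gf : ∀ i, SimpleGraph (Fv i)} {G : SimpleGraph V} {k : ℕ} {s : V} {Y : Set V}
    {𝓜 : Set (Set V)} (hY : IsFree Gf G Y)
    (h𝓜 : ∀ C ∈ 𝓜, SeclusionMaximal G (fun C => (G.induce C).Connected ∧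
      (∀ i, IsEmpty (Gf i ↪g G.induce C)) ∧ (openNbhd G C).ncard ≤ k) C)
    (hs : ∀ C ∈ 𝓜, s ∈ C) (hsub : ∀ C ∈ 𝓜, C ⊆ Y) :
    𝓜.ncard ≤ (Node.arity (fun _ : Empty => Empty) ^
      exponent (fun _ : Empty => Empty)) ^ (k + 1) := by
  rw [← mul_one ((_ : ℕ) ^ (k + 1))]
  refine ncard_le_of_leafFamily (Gf := fun _ : Empty => (⊥ : SimpleGraph Empty)) (s := s)
    (Y := Y) (fun C hC => ⟨(h𝓜 C hC).1.1, fun i => i.elim, (h𝓜 C hC).1.2.2⟩) hs hsub ?_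
  intro D U _ hUY hDU
  have hDU' : D ∩ U = ∅ := Set.eq_empty_of_forall_notMem fun v hv => hDU inferInstance v hv.1 hv.2
  by_cases hsU : s ∈ U
  swap
  · have : Node.leafFamily G 𝓜 D U = ∅ :=
      Set.eq_empty_of_forall_notMem fun C hC => hsU (hC.2.1 (hs C hC.1))
    simp [this]
  obtain ⟨A, hAU, hA, hAN, hmax⟩ := exists_connected_part G hsU
  have hsingle : Node.leafFamily G 𝓜 D U ⊆ {A} := by
    rintro C ⟨hC, hCU, hD, hcard⟩
    by_contra hne
    have hCA : C ⊂ A := (hmax C hCU (hs C hC) (h𝓜 C hC).1.1).ssubset_of_ne hne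
    rw [hDU', Set.ncard_empty, add_zero] at hcard
    have h1 := nbhdCard_add_ncard hD
    have h2 : (openNbhd G A).ncard ≤ nbhdCard G D U + D.ncard :=
      (Set.ncard_le_ncard hAN).trans (Set.ncard_le_ncard_sdiff_add_ncard _ _)
    have h3 := (h𝓜 C hC).1.2.2
    have h4 := (h𝓜 C hC).2 A hCA ⟨hA, isFree_iff.1 (hY.mono (hAU.trans hUY)), by omega⟩
    omega
  simpa using Set.ncard_le_ncard hsingle

end Secluded

open Secluded in
theorem stmt1 (ι : Type) [Fintype ι] (Fv : ι → Type) [∀ i, Fintype (Fv i)]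
    (Gf : ∀ i, SimpleGraph (Fv i)) :
    ∃ c : ℕ, 2 ≤ c ∧
      ∀ (V : Type) [Fintype V] (G : SimpleGraph V) (k : ℕ),
        {C : Set V | SeclusionMaximal G (fun C =>
            (G.induce C).Connected ∧
            (∀ i, IsEmpty ((Gf i) ↪g (G.induce C))) ∧
            (openNbhd G C).ncard ≤ k) C}.ncard ≤ c ^ (k + 1) * Fintype.card V := by
  set c₁ := Node.arity Fv ^ exponent Fv with hc₁
  set c₂ := Node.arity (fun _ : Empty => Empty) ^ exponent (fun _ : Empty => Empty) with hc₂
  have hpos₁ : 2 ≤ c₁ := (by have := Node.three_le_arity (Fv := Fv); omega : 2 ≤ _).trans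
    (Nat.le_self_pow (by unfold exponent; omega) _)
  have hpos₂ : 1 ≤ c₂ := Nat.one_le_pow _ _
    (by have := Node.three_le_arity (Fv := fun _ : Empty => Empty); omega)
  refine ⟨c₁ * c₂, hpos₁.trans (Nat.le_mul_of_pos_right _ hpos₂), fun V _ G k => ?_⟩
  set 𝓜 := {C : Set V | SeclusionMaximal G (fun C => (G.induce C).Connected ∧
    (∀ i, IsEmpty ((Gf i) ↪g (G.induce C))) ∧ (openNbhd G C).ncard ≤ k) C} with h𝓜
  have hsub : 𝓜 ⊆ ⋃ s, {C ∈ 𝓜 | s ∈ C} := by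
    intro C hC
    obtain ⟨s, hs⟩ := hC.1.1.nonempty
    exact Set.mem_iUnion.2 ⟨s, hC, hs⟩
  have hcount : ∀ s, {C ∈ 𝓜 | s ∈ C}.ncard ≤ (c₁ * c₂) ^ (k + 1) := by
    intro s
    rw [mul_pow]
    refine ncard_le_of_leafFamily (Gf := Gf) (G := G) (s := s) (Y := Set.univ)
      (fun C hC => ⟨hC.1.1.1, isFree_iff.2 hC.1.1.2.1, hC.1.1.2.2⟩) (fun C hC => hC.2)
      (fun C _ => Set.subset_univ C) fun D U hfree _ _ => ?_
    exact ncard_le_of_subset (s := s) hfree (fun C hC => hC.1.1) (fun C hC => hC.1.2)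
      fun C hC v hv => ⟨hC.2.1 hv, fun hvD => (hC.2.2.1 hvD).1 hv⟩
  calc 𝓜.ncard ≤ (⋃ s, {C ∈ 𝓜 | s ∈ C}).ncard := Set.ncard_le_ncard hsub
    _ ≤ ∑ s, {C ∈ 𝓜 | s ∈ C}.ncard := Set.ncard_iUnion_le_of_fintype _
    _ ≤ ∑ _s : V, (c₁ * c₂) ^ (k + 1) := Finset.sum_le_sum fun s _ => hcount s
    _ = (c₁ * c₂) ^ (k + 1) * Fintype.card V := by simp [mul_comm]
end
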